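/- arXiv:2108.05433 — 2 statements merged into one kernel-verified Lean document; each statement's English description precedes it below -/
import Mathlib

section
/- Fix integers d ≥ 1 and C ≥ 1, a real ρ ∈ (0,1), and points q, p* ∈ {0,1}^d. Suppose that for every finite set S ⊆ {0,1}^d we are given weights π_S : {1,…,d} → [0,1] with Σ_{i=1}^d π_S(i) = 1, and a real value f(S), such that: (i) f(S) = 1 whenever |S| ≤ C; (ii) f(S) ≥ Σ_{i : p*_i = q_i} π_S(i) · f(S_{i,q_i}) whenever |S| > C; (iii) for every S with p* ∈ S and |S| > C, Σ_{i : p*_i = q_i} π_S(i) · (|S_{i,q_i}|/|S|)^{−ρ} ≥ 1; and (iv) for every S with p* ∈ S and |S| > C and every i with π_S(i) > 0 and p*_i = q_i, one has |S_{i,q_i}| < |S|. Then f(S) ≥ |S|^{−ρ} for every nonempty finite S ⊆ {0,1}^d with p* ∈ S. -/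
/-- inductive core of the success-probability guarantee for LSH trees.
For a bucket `S ⊆ {0,1}^d`, `S.filter (fun x => x i = q i)` is `S_{i,q_i}`. -/
theorem lsh_tree_success_probability
    (d C : ℕ) (hd : 1 ≤ d) (hC : 1 ≤ C)
    (ρ : ℝ) (hρ : 0 < ρ ∧ ρ < 1)
    (q pstar : Fin d → Bool)
    (π : Finset (Fin d → Bool) → Fin d → ℝ)
    (f : Finset (Fin d → Bool) → ℝ)
    (hπ01 : ∀ (S : Finset (Fin d → Bool)) (i : Fin d), 0 ≤ π S i ∧ π S i ≤ 1)
    (hπsum : ∀ S : Finset (Fin d → Bool), ∑ i : Fin d, π S i = 1)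
    (hbase : ∀ S : Finset (Fin d → Bool), S.card ≤ C → f S = 1)
    (hrec : ∀ S : Finset (Fin d → Bool), C < S.card →
      ∑ i ∈ Finset.univ.filter (fun i : Fin d => pstar i = q i),
        π S i * f (S.filter (fun x => x i = q i)) ≤ f S)
    (hobj : ∀ S : Finset (Fin d → Bool), pstar ∈ S → C < S.card →
      1 ≤ ∑ i ∈ Finset.univ.filter (fun i : Fin d => pstar i = q i),
        π S i * ((((S.filter (fun x => x i = q i)).card : ℝ) / (S.card : ℝ)) ^ (-ρ)))
    (hshrink : ∀ S : Finset (Fin d → Bool), pstar ∈ S → C < S.card →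
      ∀ i : Fin d, 0 < π S i → pstar i = q i →
        (S.filter (fun x => x i = q i)).card < S.card) :
    ∀ S : Finset (Fin d → Bool), S.Nonempty → pstar ∈ S →
      ((S.card : ℝ)) ^ (-ρ) ≤ f S := by
  intro S
  induction S using Finset.strongInduction with
  | H S ih =>
    intro hS hp
    have hcard : (0 : ℝ) < S.card := by exact_mod_cast hS.card_pos
    rcases le_or_gt S.card C with h | h
    · rw [hbase S h]
      exact Real.rpow_le_one_of_one_le_of_nonpos (by exact_mod_cast hS.card_pos) (by linarith)
    · calc (S.card : ℝ) ^ (-ρ)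
          ≤ (∑ i ∈ Finset.univ.filter (fun i : Fin d => pstar i = q i),
              π S i * ((((S.filter (fun x => x i = q i)).card : ℝ) / (S.card : ℝ)) ^ (-ρ))) *
              (S.card : ℝ) ^ (-ρ) :=
            le_mul_of_one_le_left (Real.rpow_nonneg hcard.le _) (hobj S hp h)
        _ = ∑ i ∈ Finset.univ.filter (fun i : Fin d => pstar i = q i),
              π S i * ((S.filter (fun x => x i = q i)).card : ℝ) ^ (-ρ) := by
            rw [Finset.sum_mul]
            refine Finset.sum_congr rfl fun i _ => ?_
            rw [mul_assoc, ← Real.mul_rpow (by positivity) hcard.le, div_mul_cancel₀ _ hcard.ne']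
        _ ≤ ∑ i ∈ Finset.univ.filter (fun i : Fin d => pstar i = q i),
              π S i * f (S.filter (fun x => x i = q i)) := by
            refine Finset.sum_le_sum fun i hi => ?_
            have hi : pstar i = q i := (Finset.mem_filter.mp hi).2
            rcases (hπ01 S i).1.eq_or_lt with h0 | h0
            · simp [← h0]
            · have hmem : pstar ∈ S.filter (fun x => x i = q i) := Finset.mem_filter.mpr ⟨hp, hi⟩
              have hsub : S.filter (fun x => x i = q i) ⊂ S :=
                (Finset.filter_subset _ S).ssubset_of_ne fun he =>
                  (hshrink S hp h i h0 hi).ne (congrArg Finset.card he)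
              exact mul_le_mul_of_nonneg_left (ih _ hsub ⟨_, hmem⟩ hmem) h0.le
        _ ≤ f S := hrec S h
end

section
/- Let d ≥ 1 be an integer, q ∈ {0,1}^d, and S a nonempty finite subset of {0,1}^d such that for every coordinate i ∈ {1,…,d} there exists x ∈ S with x_i = q_i. Let ρ ∈ (0,1], δ ∈ [0,1], and t a real with 0 ≤ t < d, and suppose at least (1−δ)|S| of the points p ∈ S satisfy ‖p − q‖₁ ≥ t. Writing f_i = |{x ∈ S : x_i = q_i}|/|S|, one has (1/d)·Σ_{i=1}^d f_i^{−ρ} ≥ (δ + (1−δ)(1 − t/d))^{−ρ}. -/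
/-- The tangent line at `a` lies below the graph of `x ↦ x ^ (-ρ)`. -/
theorem rpow_neg_tangent_le {ρ a x : ℝ} (hρ : 0 ≤ ρ) (ha : 0 < a) (hx : 0 < x) :
    a ^ (-ρ) * (1 - ρ * (x / a - 1)) ≤ x ^ (-ρ) := by
  have hu : 0 < x / a := div_pos hx ha
  have hlog : 1 - ρ * (x / a - 1) ≤ (x / a) ^ (-ρ) := by
    rw [Real.rpow_def_of_pos hu]
    have h₁ := Real.add_one_le_exp (Real.log (x / a) * -ρ)
    have h₂ := mul_le_mul_of_nonneg_left (Real.log_le_sub_one_of_pos hu) hρ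
    linarith
  calc a ^ (-ρ) * (1 - ρ * (x / a - 1)) ≤ a ^ (-ρ) * (x / a) ^ (-ρ) := by gcongr
    _ = x ^ (-ρ) := by rw [← Real.mul_rpow ha.le hu.le, mul_div_cancel₀ _ ha.ne']

/-- Jensen's inequality for `x ↦ x ^ (-ρ)`, with an upper bound for the mean. -/
theorem rpow_neg_le_mean_rpow_neg {ι : Type*} [Fintype ι] [Nonempty ι] {ρ a : ℝ} {f : ι → ℝ}
    (hρ : 0 ≤ ρ) (ha : 0 < a) (hf : ∀ i, 0 < f i) (hmean : ∑ i, f i ≤ Fintype.card ι * a) :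
    a ^ (-ρ) ≤ (1 / (Fintype.card ι : ℝ)) * ∑ i, f i ^ (-ρ) := by
  have hcard : (0 : ℝ) < Fintype.card ι := by exact_mod_cast Fintype.card_pos
  have hdiv : (∑ i, f i) / a ≤ Fintype.card ι := (div_le_iff₀ ha).2 hmean
  have hsum : ∑ i, a ^ (-ρ) * (1 - ρ * (f i / a - 1)) =
      a ^ (-ρ) * (Fintype.card ι - ρ * ((∑ i, f i) / a - Fintype.card ι)) := by
    rw [← Finset.mul_sum, Finset.sum_sub_distrib, ← Finset.mul_sum, Finset.sum_sub_distrib,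
      ← Finset.sum_div]
    simp
  rw [one_div, ← div_eq_inv_mul, le_div_iff₀ hcard]
  calc a ^ (-ρ) * (Fintype.card ι : ℝ)
      ≤ a ^ (-ρ) * (Fintype.card ι - ρ * ((∑ i, f i) / a - Fintype.card ι)) := by
        gcongr
        nlinarith
    _ ≤ ∑ i, f i ^ (-ρ) :=
        hsum ▸ Finset.sum_le_sum fun i _ => rpow_neg_tangent_le hρ ha (hf i)

theorem card_agree_add_hammingDist {ι : Type*} [Fintype ι] {β : ι → Type*}
    [∀ i, DecidableEq (β i)] (x y : ∀ i, β i) :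
    (Finset.univ.filter fun i => x i = y i).card + hammingDist x y = Fintype.card ι :=
  Finset.card_filter_add_card_filter_not (s := Finset.univ) fun i => x i = y i

/-- Counting agreements with `q` by coordinate or by point of `S`. -/
theorem sum_card_agree_add_sum_hammingDist {ι : Type*} [Fintype ι] {β : ι → Type*}
    [∀ i, DecidableEq (β i)] (S : Finset (∀ i, β i)) (q : ∀ i, β i) :
    ∑ i, (S.filter fun x => x i = q i).card + ∑ x ∈ S, hammingDist x q =
      S.card * Fintype.card ι := by
  have hswap : ∑ i, (S.filter fun x => x i = q i).card =
      ∑ x ∈ S, (Finset.univ.filter fun i => x i = q i).card := by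
    simp only [Finset.card_filter]
    exact Finset.sum_comm
  rw [hswap, ← Finset.sum_add_distrib,
    Finset.sum_congr rfl fun x _ => card_agree_add_hammingDist x q, Finset.sum_const, smul_eq_mul]

theorem card_filter_mul_le_sum_hammingDist {ι : Type*} [Fintype ι] {β : ι → Type*}
    [∀ i, DecidableEq (β i)] (S : Finset (∀ i, β i)) (q : ∀ i, β i) (t : ℝ) :
    ((S.filter fun p => t ≤ (hammingDist p q : ℝ)).card : ℝ) * t ≤
      ∑ x ∈ S, (hammingDist x q : ℝ) := by
  rw [← nsmul_eq_mul]
  exact (Finset.card_nsmul_le_sum _ _ t fun x hx => (Finset.mem_filter.1 hx).2).trans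
    (Finset.sum_le_sum_of_subset_of_nonneg (Finset.filter_subset _ _)
      fun _ _ _ => Nat.cast_nonneg _)

/-- a uniformly random hash coordinate achieves, in expectation, objective
value at least `(δ + (1-δ)(1 - t/d))^(-ρ)`, where `f_i` is the fraction of the bucket `S`
agreeing with the query `q` at coordinate `i`. -/
theorem uniform_coordinate_objective
    (d : ℕ) (hd : 1 ≤ d) (q : Fin d → Bool) (S : Finset (Fin d → Bool))
    (hS : S.Nonempty)
    (hfull : ∀ i : Fin d, ∃ x ∈ S, x i = q i)
    (ρ δ t : ℝ) (hρ : 0 < ρ ∧ ρ ≤ 1) (hδ : 0 ≤ δ ∧ δ ≤ 1) (ht : 0 ≤ t ∧ t < (d : ℝ))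
    (hfar : (1 - δ) * (S.card : ℝ) ≤
      ((S.filter (fun p => t ≤ (hammingDist p q : ℝ))).card : ℝ)) :
    (δ + (1 - δ) * (1 - t / d)) ^ (-ρ) ≤
      (1 / (d : ℝ)) * ∑ i : Fin d,
        (((S.filter (fun x => x i = q i)).card : ℝ) / (S.card : ℝ)) ^ (-ρ) := by
  have hd₀ : (0 : ℝ) < d := by exact_mod_cast hd
  have hS₀ : (0 : ℝ) < S.card := by exact_mod_cast hS.card_pos
  have : Nonempty (Fin d) := ⟨⟨0, hd⟩⟩
  have htd : 0 < 1 - t / d := sub_pos.2 ((div_lt_one hd₀).2 ht.2)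
  have hM : 0 < δ + (1 - δ) * (1 - t / d) := by
    have h₁ : 0 ≤ t / d := div_nonneg ht.1 hd₀.le
    nlinarith [mul_nonneg hδ.1 h₁]
  have hf : ∀ i, 0 < ((S.filter (fun x => x i = q i)).card : ℝ) / (S.card : ℝ) := fun i => by
    obtain ⟨x, hx, hxi⟩ := hfull i
    have : 0 < (S.filter fun x => x i = q i).card :=
      Finset.card_pos.2 ⟨x, Finset.mem_filter.2 ⟨hx, hxi⟩⟩
    exact div_pos (by exact_mod_cast this) hS₀
  have hcount : ∑ i, ((S.filter fun x => x i = q i).card : ℝ) +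
      ∑ x ∈ S, (hammingDist x q : ℝ) = S.card * d := by
    have h := sum_card_agree_add_sum_hammingDist S q
    rw [Fintype.card_fin] at h
    exact_mod_cast h
  have hmean : ∑ i, ((S.filter (fun x => x i = q i)).card : ℝ) / (S.card : ℝ) ≤
      Fintype.card (Fin d) * (δ + (1 - δ) * (1 - t / d)) := by
    have hM_eq : (d : ℝ) * (δ + (1 - δ) * (1 - t / d)) = d - (1 - δ) * t := by
      field_simp
      ring
    rw [← Finset.sum_div, div_le_iff₀ hS₀, Fintype.card_fin, hM_eq]
    have h₁ := card_filter_mul_le_sum_hammingDist S q t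
    have h₂ := mul_le_mul_of_nonneg_right hfar ht.1
    linarith
  simpa only [Fintype.card_fin] using rpow_neg_le_mean_rpow_neg hρ.1.le hM hf hmean
end
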